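/- arXiv:2511.02638 — 8 statements merged into one kernel-verified Lean document; each statement's English description precedes it below -/
import Mathlib

section
/- Let ι be a finite nonempty index type partitioned by a map b : ι → β into finitely many nonempty blocks, and let Δ = {x : ι → ℝ | x i ≥ 0 for all i, and Σ_{i : b i = k} x i = 1 for every k : β} be the corresponding product of simplices. Suppose J : (ι → ℝ) → ℝ is Fréchet differentiable at x* and x* minimizes J over Δ. Then for every i with x* i > 0 and every j in the same block (b j = b i), one has ∂_i J(x*) ≤ ∂_j J(x*); equivalently, ∂_i J(x*) = min over the block whenever x* i > 0, and ∂_i J(x*) ≥ the block minimum whenever x* i = 0. -/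
/-- **Node-level KKT necessary conditions on a product of simplices.**
If `J` is Fréchet differentiable at `x*` and `x*` minimizes `J` over the product of
simplices `Δ = {x | x i ≥ 0, ∑_{i : b i = k} x i = 1 for all k}`, then for every `i`
with `x* i > 0` and every `j` in the same block, `∂_i J(x*) ≤ ∂_j J(x*)`. -/
theorem kkt_product_of_simplices
    {ι β : Type*} [Fintype ι] [Nonempty ι] [DecidableEq ι] [Fintype β] [DecidableEq β]
    (b : ι → β) (hb : ∀ k : β, ∃ i : ι, b i = k)
    (J : (ι → ℝ) → ℝ) (xstar : ι → ℝ) (J' : (ι → ℝ) →L[ℝ] ℝ)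
    (hdiff : HasFDerivAt J J' xstar)
    (hmem : (∀ i, 0 ≤ xstar i) ∧
      (∀ k : β, ∑ i ∈ Finset.univ.filter (fun i => b i = k), xstar i = 1))
    (hmin : ∀ x : ι → ℝ,
      ((∀ i, 0 ≤ x i) ∧
        (∀ k : β, ∑ i ∈ Finset.univ.filter (fun i => b i = k), x i = 1)) →
      J xstar ≤ J x) :
    ∀ i j : ι, 0 < xstar i → b j = b i →
      J' (Pi.single i 1) ≤ J' (Pi.single j 1) := by
  intro i j hi hji
  set S : Set (ι → ℝ) := {x | (∀ i, 0 ≤ x i) ∧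
        (∀ k : β, ∑ i ∈ Finset.univ.filter (fun i => b i = k), x i = 1)} with hS
  have hconv : Convex ℝ S := by
    intro x hx y hy s t hs ht hst
    refine ⟨fun l => ?_, fun k => ?_⟩
    · have h1 := mul_nonneg hs (hx.1 l)
      have h2 := mul_nonneg ht (hy.1 l)
      simpa using add_nonneg h1 h2
    · simp only [Pi.add_apply, Pi.smul_apply, smul_eq_mul, Finset.sum_add_distrib,
        ← Finset.mul_sum]
      rw [hx.2 k, hy.2 k]
      linarith
  set d : ι → ℝ := xstar i • (Pi.single j 1 - Pi.single i 1) with hd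
  have hy : xstar + d ∈ S := by
    refine ⟨fun l => ?_, fun k => ?_⟩
    · have h1 := hmem.1 l
      simp only [hd, Pi.add_apply, Pi.smul_apply, Pi.sub_apply, smul_eq_mul, Pi.single_apply]
      by_cases hl : l = i
      · subst hl
        split_ifs <;> simp_all
      · split_ifs <;> simp <;> linarith
    · simp only [hd, Pi.add_apply, Pi.smul_apply, Pi.sub_apply, smul_eq_mul,
        Finset.sum_add_distrib, ← Finset.mul_sum, Finset.sum_sub_distrib, hmem.2 k]
      simp [Pi.single_apply, Finset.sum_ite_eq', hji]
  have hlm : IsLocalMinOn J S xstar := by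
    have : IsMinOn J S xstar := fun x hx => hmin x hx
    exact this.localize
  have hc : d ∈ posTangentConeAt S xstar := by
    apply mem_posTangentConeAt_of_segment_subset
    exact hconv.segment_subset hmem hy
  have h := hlm.hasFDerivWithinAt_nonneg hdiff.hasFDerivWithinAt hc
  rw [hd, map_smul, map_sub, smul_eq_mul] at h
  have := nonneg_of_mul_nonneg_right h hi
  linarith
end

section
/- Let V be a finite node set, X ⊆ V a host set, and φ : V → V → ℝ a loop-free routing variable satisfying flow conservation with respect to X (Σ_j φ i j = 1 for i ∉ X, and φ i j = 0 for all j when i ∈ X). Let r : V → ℝ with r i ≥ 0, let t be the unique traffic assignment (t i = r i + Σ_j φ j i · t j) and f i j = φ i j · t i the induced edge flows. Let d : V → V → ℝ be arbitrary per-edge delays and let D : V → ℝ be the unique solution of D i = Σ_j φ i j · (d i j + D j) (so D i = 0 for i ∈ X). Then the total link-delay cost equals the rate-weighted expected path delays: Σ_{i,j ∈ V} f i j · d i j = Σ_{i ∈ V} r i · D i. -/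
/-- **Total link-delay cost equals rate-weighted expected path delays.**
For a loop-free routing variable `φ` satisfying flow conservation w.r.t. the host set
`X`, with traffic assignment `t`, induced edge flows `f i j = φ i j * t i`, per-edge
delays `d`, and expected path delays `D` solving `D i = ∑ j, φ i j * (d i j + D j)`
(so `D i = 0` on `X`), one has `∑ i j, f i j * d i j = ∑ i, r i * D i`. -/
theorem total_link_cost_eq_rate_weighted_path_delay
    {V : Type*} [Fintype V] [DecidableEq V]
    (X : Finset V)
    (φ : V → V → ℝ) (hφ : ∀ i j, 0 ≤ φ i j)
    (ord : V → ℕ) (hord : Function.Injective ord)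
    (hloop : ∀ i j, 0 < φ i j → ord i < ord j)
    (hcons : ∀ i ∉ X, ∑ j, φ i j = 1)
    (hhost : ∀ i ∈ X, ∀ j, φ i j = 0)
    (r : V → ℝ) (hr : ∀ i, 0 ≤ r i)
    (t : V → ℝ) (ht : ∀ i, t i = r i + ∑ j, φ j i * t j)
    (f : V → V → ℝ) (hf : ∀ i j, f i j = φ i j * t i)
    (d : V → V → ℝ)
    (D : V → ℝ) (hD : ∀ i, D i = ∑ j, φ i j * (d i j + D j)) :
    ∑ i, ∑ j, f i j * d i j = ∑ i, r i * D i := by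
  have h1 : ∑ i, t i * D i = ∑ i, ∑ j, f i j * d i j + ∑ i, ∑ j, φ i j * t i * D j := by
    rw [← Finset.sum_add_distrib]
    refine Finset.sum_congr rfl fun i _ => ?_
    rw [hD i, Finset.mul_sum, ← Finset.sum_add_distrib]
    refine Finset.sum_congr rfl fun j _ => ?_
    rw [hf]; ring
  have h2 : ∑ i, t i * D i = ∑ i, r i * D i + ∑ i, ∑ j, φ j i * t j * D i := by
    rw [← Finset.sum_add_distrib]
    refine Finset.sum_congr rfl fun i _ => ?_
    rw [← Finset.sum_mul, ← add_mul, ← ht i]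
  rw [Finset.sum_comm] at h2
  linarith
end

section
/- Let V be a finite node set, X ⊆ V a host set, and φ : V → V → ℝ a loop-free routing variable satisfying flow conservation with respect to X. Let r : V → ℝ with r i ≥ 0, let t be the unique traffic assignment and f i j = φ i j · t i. Fix request-packet size L_req ≥ 0 and result-packet size L_res ≥ 0, per-edge delays d : V → V → ℝ, and per-host processing delays c : V → ℝ. Define the round-trip latency D° : V → ℝ as the unique solution of D° i = c i for i ∈ X and D° i = Σ_j φ i j · (L_req · d i j + L_res · d j i + D° j) for i ∉ X. Then Σ_{i,j ∈ V} f i j · (L_req · d i j + L_res · d j i) + Σ_{i ∈ X} t i · c i = Σ_{i ∈ V} r i · D° i. -/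
/-- **Round-trip accounting identity.** For a loop-free, flow-conserving routing
variable `φ` with traffic assignment `t`, edge flows `f i j = φ i j * t i`, request
and result packet sizes `Lreq, Lres ≥ 0`, per-edge delays `d`, host processing delays
`c`, and round-trip latencies `D°` solving `D° i = c i` on `X` and
`D° i = ∑ j, φ i j * (Lreq * d i j + Lres * d j i + D° j)` off `X`, the total network
cost equals the rate-weighted round-trip latencies. -/
theorem round_trip_accounting
    {V : Type*} [Fintype V] [DecidableEq V]
    (X : Finset V)
    (φ : V → V → ℝ) (hφ : ∀ i j, 0 ≤ φ i j)
    (ord : V → ℕ) (hord : Function.Injective ord)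
    (hloop : ∀ i j, 0 < φ i j → ord i < ord j)
    (hcons : ∀ i ∉ X, ∑ j, φ i j = 1)
    (hhost : ∀ i ∈ X, ∀ j, φ i j = 0)
    (r : V → ℝ) (hr : ∀ i, 0 ≤ r i)
    (t : V → ℝ) (ht : ∀ i, t i = r i + ∑ j, φ j i * t j)
    (f : V → V → ℝ) (hf : ∀ i j, f i j = φ i j * t i)
    (Lreq Lres : ℝ) (hLreq : 0 ≤ Lreq) (hLres : 0 ≤ Lres)
    (d : V → V → ℝ) (c : V → ℝ)
    (Do : V → ℝ)
    (hDoX : ∀ i ∈ X, Do i = c i)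
    (hDo : ∀ i ∉ X, Do i = ∑ j, φ i j * (Lreq * d i j + Lres * d j i + Do j)) :
    (∑ i, ∑ j, f i j * (Lreq * d i j + Lres * d j i)) + ∑ i ∈ X, t i * c i
      = ∑ i, r i * Do i := by
  have h1 : ∀ i, t i * Do i = (∑ j, f i j * (Lreq * d i j + Lres * d j i))
      + (∑ j, φ i j * t i * Do j) + (if i ∈ X then t i * c i else 0) := by
    intro i
    by_cases hi : i ∈ X
    · simp [hi, hf, hhost i hi, hDoX i hi]
    · rw [hDo i hi, Finset.mul_sum, ← Finset.sum_add_distrib, if_neg hi, add_zero]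
      refine Finset.sum_congr rfl fun j _ => ?_
      rw [hf]
      ring
  have h2 : ∀ i, r i * Do i = t i * Do i - ∑ j, φ j i * t j * Do i := by
    intro i
    have h := ht i
    rw [← Finset.sum_mul, ← sub_mul]
    congr 1
    linarith
  have h3 : ∑ i ∈ X, t i * c i = ∑ i, if i ∈ X then t i * c i else 0 := by
    simp
  rw [Finset.sum_congr rfl fun i _ => h2 i, Finset.sum_sub_distrib,
    Finset.sum_congr rfl fun i _ => h1 i, Finset.sum_add_distrib, Finset.sum_add_distrib, h3,
    Finset.sum_comm (f := fun i j => φ j i * t j * Do i)]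
  ring
end

section
/- Let V be a finite node set, X ⊆ V a host set, and φ : V → V → ℝ a loop-free routing variable satisfying flow conservation with respect to X. For r : V → ℝ let t(r) be the unique traffic assignment and f i j (r) = φ i j · t i (r). Let each edge cost c_{ij} : ℝ → ℝ and each host cost h_i : ℝ → ℝ (i ∈ X) be differentiable, and define J(r) = Σ_{i,j} c_{ij}(f i j (r)) + Σ_{i ∈ X} h_i(t i (r)). Then J is differentiable in r, and ∂J/∂r_i = δ_i, where δ : V → ℝ is the unique solution of the backward recursion δ_i = h_i'(t i) for i ∈ X and δ_i = Σ_j φ i j · (c_{ij}'(f i j) + δ_j) for i ∉ X. -/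
/-- **Recursive gradient decomposition w.r.t. exogenous rates (static core of
Theorem 2).** For a loop-free, flow-conserving routing variable `φ`, let `t ρ` be the
unique traffic assignment for exogenous rates `ρ`, `f i j (ρ) = φ i j * t ρ i` the
edge flows, and `J ρ = ∑ i j, c i j (f i j ρ) + ∑ i ∈ X, h i (t ρ i)` with
differentiable edge and host costs. Then `J` is differentiable at `r` and
`∂J/∂r i = δ i`, where `δ` solves the backward recursion `δ i = (h i)'(t r i)` on `X`
and `δ i = ∑ j, φ i j * ((c i j)'(f i j) + δ j)` off `X`. -/
theorem gradient_decomposition_rates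
    {V : Type*} [Fintype V] [DecidableEq V]
    (X : Finset V)
    (φ : V → V → ℝ) (hφ : ∀ i j, 0 ≤ φ i j)
    (ord : V → ℕ) (hord : Function.Injective ord)
    (hloop : ∀ i j, 0 < φ i j → ord i < ord j)
    (hcons : ∀ i ∉ X, ∑ j, φ i j = 1)
    (hhost : ∀ i ∈ X, ∀ j, φ i j = 0)
    (t : (V → ℝ) → V → ℝ)
    (ht : ∀ ρ : V → ℝ, ∀ i, t ρ i = ρ i + ∑ j, φ j i * t ρ j)
    (c : V → V → ℝ → ℝ) (hc : ∀ i j, Differentiable ℝ (c i j))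
    (h : V → ℝ → ℝ) (hh : ∀ i, Differentiable ℝ (h i))
    (J : (V → ℝ) → ℝ)
    (hJ : ∀ ρ : V → ℝ,
      J ρ = (∑ i, ∑ j, c i j (φ i j * t ρ i)) + ∑ i ∈ X, h i (t ρ i))
    (r : V → ℝ)
    (δ : V → ℝ)
    (hδX : ∀ i ∈ X, δ i = deriv (h i) (t r i))
    (hδ : ∀ i ∉ X, δ i = ∑ j, φ i j * (deriv (c i j) (φ i j * t r i) + δ j)) :
    DifferentiableAt ℝ J r ∧ ∀ i, fderiv ℝ J r (Pi.single i 1) = δ i := by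
  have hlin : ∀ n : ℕ, ∀ i, ord i = n →
      ∃ T : (V → ℝ) →L[ℝ] ℝ, ∀ ρ, t ρ i = T ρ := by
    intro n
    induction n using Nat.strong_induction_on with
    | _ n ih =>
      intro i hi
      have key : ∀ j, ∃ T : (V → ℝ) →L[ℝ] ℝ, ∀ ρ, φ j i * t ρ j = T ρ := by
        intro j
        rcases (hφ j i).eq_or_lt with h0 | h0
        · exact ⟨0, fun ρ => by simp [← h0]⟩
        · obtain ⟨T, hT⟩ := ih (ord j) (hi ▸ hloop j i h0) j rfl
          exact ⟨φ j i • T, fun ρ => by simp [hT ρ]⟩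
      choose S hS using key
      refine ⟨ContinuousLinearMap.proj (R := ℝ) (φ := fun _ : V => ℝ) i + ∑ j, S j,
        fun ρ => ?_⟩
      rw [ht ρ i]
      simp [hS, ContinuousLinearMap.sum_apply]
  have hlin' : ∀ i, ∃ T : (V → ℝ) →L[ℝ] ℝ, ∀ ρ, t ρ i = T ρ :=
    fun i => hlin _ i rfl
  choose T hT using hlin'
  have hTd : ∀ i, HasFDerivAt (fun ρ => t ρ i) (T i) r := by
    intro i
    have e : (fun ρ => t ρ i) = T i := funext (hT i)
    rw [e]
    exact (T i).hasFDerivAt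
  have hJd : HasFDerivAt J
      ((∑ i, ∑ j, deriv (c i j) (φ i j * t r i) • (φ i j • T i))
        + ∑ i ∈ X, deriv (h i) (t r i) • T i) r := by
    have e : J = fun ρ => (∑ i, ∑ j, c i j (φ i j * t ρ i)) + ∑ i ∈ X, h i (t ρ i) :=
      funext hJ
    rw [e]
    refine HasFDerivAt.add (HasFDerivAt.fun_sum fun i _ => HasFDerivAt.fun_sum fun j _ => ?_)
      (HasFDerivAt.fun_sum fun i _ => ?_)
    · exact ((hc i j) (φ i j * t r i)).hasDerivAt.comp_hasFDerivAt r ((hTd i).const_mul (φ i j))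
    · exact ((hh i) (t r i)).hasDerivAt.comp_hasFDerivAt r (hTd i)
  refine ⟨hJd.differentiableAt, fun k => ?_⟩
  rw [hJd.fderiv]
  set v : V → ℝ := Pi.single k 1 with hv
  have hδall : ∀ i, δ i = (∑ j, φ i j * deriv (c i j) (φ i j * t r i))
      + (if i ∈ X then deriv (h i) (t r i) else 0) + ∑ j, φ i j * δ j := by
    intro i
    by_cases hi : i ∈ X
    · simp [hi, hhost i hi, hδX i hi]
    · rw [hδ i hi]
      simp [hi, mul_add, Finset.sum_add_distrib]
  have hTv : ∀ i, v i = T i v - ∑ j, φ j i * T j v := by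
    intro i
    have := ht v i
    simp only [hT] at this
    linarith
  have hk : δ k = ∑ i, δ i * v i := by
    simp [hv, Pi.single_apply]
  have hswap : ∑ i, δ i * ∑ j, φ j i * T j v = ∑ i, (∑ j, φ i j * δ j) * T i v := by
    simp only [Finset.mul_sum, Finset.sum_mul]
    rw [Finset.sum_comm]
    exact Finset.sum_congr rfl fun i _ => Finset.sum_congr rfl fun j _ => by ring
  have hX : ∑ i ∈ X, deriv (h i) (t r i) * T i v
      = ∑ i, (if i ∈ X then deriv (h i) (t r i) else 0) * T i v := by
    simp [ite_mul]
  have hC : ∑ i, ∑ j, deriv (c i j) (φ i j * t r i) * (φ i j * T i v)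
      = ∑ i, (∑ j, φ i j * deriv (c i j) (φ i j * t r i)) * T i v := by
    simp only [Finset.sum_mul]
    exact Finset.sum_congr rfl fun i _ => Finset.sum_congr rfl fun j _ => by ring
  have hfin : ∑ i, δ i * v i = ∑ i, δ i * T i v - ∑ i, (∑ j, φ i j * δ j) * T i v := by
    rw [← hswap, ← Finset.sum_sub_distrib]
    exact Finset.sum_congr rfl fun i _ => by rw [hTv i]; ring
  rw [hk, hfin, ← Finset.sum_sub_distrib]
  simp only [add_apply, ContinuousLinearMap.add_apply, ContinuousLinearMap.sum_apply,
    ContinuousLinearMap.smul_apply, smul_eq_mul]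
  rw [hX, hC, ← Finset.sum_add_distrib]
  refine Finset.sum_congr rfl fun i _ => ?_
  have := hδall i
  rw [← sub_mul, ← add_mul]
  congr 1
  linarith
end

section
/- Let V be a finite node set, X ⊆ V a host set, and fix exogenous rates r : V → ℝ with r i ≥ 0. For a loop-free routing variable φ satisfying flow conservation with respect to X, let t(φ) be the unique traffic assignment, f i j (φ) = φ i j · t i (φ), and define J(φ) = Σ_{i,j} c_{ij}(f i j (φ)) + Σ_{i ∈ X} h_i(t i (φ)) with differentiable edge costs c_{ij} : ℝ → ℝ and host costs h_i : ℝ → ℝ. Then at any loop-free flow-conserving φ, J is differentiable with respect to the entries of φ (regarded as an element of ℝ^{V×V}), and for every i ∉ X and every j, ∂J/∂φ_{ij} = t_i · (c_{ij}'(f i j) + δ_j), where δ : V → ℝ is the unique solution of δ_k = h_k'(t k) for k ∈ X and δ_k = Σ_l φ k l · (c_{kl}'(f k l) + δ_l) for k ∉ X. -/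
open Filter


theorem diffAt_det_aux {V : Type*} [Fintype V] [DecidableEq V] {E : Type*}
    [NormedAddCommGroup E] [NormedSpace ℝ E] (M : E → Matrix V V ℝ) (x : E)
    (hM : ∀ i j, DifferentiableAt ℝ (fun y => M y i j) x) :
    DifferentiableAt ℝ (fun y => (M y).det) x := by
  simp only [Matrix.det_apply']
  refine DifferentiableAt.fun_sum fun σ _ => ?_
  refine DifferentiableAt.const_mul ?_ _
  exact (HasFDerivAt.finsetProd fun i _ => (hM (σ i) i).hasFDerivAt).differentiableAt

theorem diffAt_t_aux {V : Type*} [Fintype V] [DecidableEq V]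
    (φ : V → V → ℝ) (hφ : ∀ i j, 0 ≤ φ i j)
    (ord : V → ℕ)
    (hloop : ∀ i j, 0 < φ i j → ord i < ord j)
    (r : V → ℝ)
    (t : (V → V → ℝ) → V → ℝ)
    (ht : ∀ᶠ ψ in nhds φ, ∀ i, t ψ i = r i + ∑ j, ψ j i * t ψ j) (k : V) :
    DifferentiableAt ℝ (fun ψ => t ψ k) φ := by
  let A : (V → V → ℝ) → Matrix V V ℝ := fun ψ => 1 - (Matrix.of ψ).transpose
  have hA : ∀ i j, DifferentiableAt ℝ (fun ψ => A ψ i j) φ := by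
    intro i j
    simp only [A, Matrix.sub_apply, Matrix.transpose_apply, Matrix.of_apply]
    fun_prop
  have hd := diffAt_det_aux A φ hA
  have hd0 : (A φ).det ≠ 0 := by
    intro h0
    obtain ⟨v, hv, hv0⟩ := Matrix.exists_mulVec_eq_zero_iff.mpr h0
    apply hv
    have key : ∀ k, v k = ∑ j, φ j k * v j := by
      intro k
      have := congrFun hv0 k
      simp only [A, Matrix.sub_mulVec, Matrix.one_mulVec, Pi.sub_apply, Pi.zero_apply] at this
      simp only [Matrix.mulVec, dotProduct, Matrix.transpose_apply, Matrix.of_apply] at this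
      linarith
    have : ∀ n k, ord k = n → v k = 0 := by
      intro n
      induction n using Nat.strong_induction_on with
      | _ n ih =>
        intro k hk
        rw [key k]
        refine Finset.sum_eq_zero fun j _ => ?_
        rcases (hφ j k).eq_or_lt with h | h
        · rw [← h, zero_mul]
        · rw [ih (ord j) (hk ▸ hloop j k h) j rfl, mul_zero]
    funext k
    exact this _ k rfl
  have hc : DifferentiableAt ℝ (fun ψ => ((A ψ).updateCol k r).det) φ := by
    apply diffAt_det_aux
    intro i j
    by_cases hj : j = k
    · subst hj
      simp
    · simpa [Matrix.updateCol_apply, hj] using hA i j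
  have hne := hd.continuousAt.eventually_ne hd0
  refine (hc.fun_mul (hd.fun_inv hd0)).congr_of_eventuallyEq ?_
  filter_upwards [ht, hne] with ψ h1 h2
  have h3 : (A ψ).mulVec (t ψ) = r := by
    funext i
    simp only [A, Matrix.sub_mulVec, Matrix.one_mulVec, Pi.sub_apply]
    simp only [Matrix.mulVec, dotProduct, Matrix.transpose_apply, Matrix.of_apply]
    linarith [h1 i]
  have h4 : Matrix.cramer (A ψ) r = (A ψ).det • t ψ := by
    rw [Matrix.cramer_eq_adjugate_mulVec, ← h3, Matrix.mulVec_mulVec, Matrix.adjugate_mul,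
      Matrix.smul_mulVec, Matrix.one_mulVec]
  have h5 := congrFun h4 k
  rw [Matrix.cramer_apply] at h5
  rw [h5, Pi.smul_apply, smul_eq_mul]
  field_simp

/-- **Routing-derivative formula of Theorem 2.** Fix exogenous rates `r ≥ 0` and a
loop-free, flow-conserving routing variable `φ`. Let `t ψ` denote the traffic
assignment induced by routing variables `ψ` (well-defined near `φ`), and
`J ψ = ∑ i j, c i j (ψ i j * t ψ i) + ∑ i ∈ X, h i (t ψ i)`. Then `J` is
differentiable in the entries of the routing variable at `φ`, and for every `i ∉ X`
and every `j`, `∂J/∂φ i j = t i * ((c i j)'(f i j) + δ j)` with `δ` solving the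
backward recursion. -/
theorem gradient_decomposition_routing
    {V : Type*} [Fintype V] [DecidableEq V]
    (X : Finset V)
    (φ : V → V → ℝ) (hφ : ∀ i j, 0 ≤ φ i j)
    (ord : V → ℕ) (hord : Function.Injective ord)
    (hloop : ∀ i j, 0 < φ i j → ord i < ord j)
    (hcons : ∀ i ∉ X, ∑ j, φ i j = 1)
    (hhost : ∀ i ∈ X, ∀ j, φ i j = 0)
    (r : V → ℝ) (hr : ∀ i, 0 ≤ r i)
    (t : (V → V → ℝ) → V → ℝ)
    (ht : ∀ᶠ ψ in nhds φ, ∀ i, t ψ i = r i + ∑ j, ψ j i * t ψ j)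
    (c : V → V → ℝ → ℝ) (hc : ∀ i j, Differentiable ℝ (c i j))
    (h : V → ℝ → ℝ) (hh : ∀ i, Differentiable ℝ (h i))
    (J : (V → V → ℝ) → ℝ)
    (hJ : ∀ ψ : V → V → ℝ,
      J ψ = (∑ i, ∑ j, c i j (ψ i j * t ψ i)) + ∑ i ∈ X, h i (t ψ i))
    (δ : V → ℝ)
    (hδX : ∀ k ∈ X, δ k = deriv (h k) (t φ k))
    (hδ : ∀ k ∉ X, δ k = ∑ l, φ k l * (deriv (c k l) (φ k l * t φ k) + δ l)) :
    DifferentiableAt ℝ J φ ∧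
      ∀ i ∉ X, ∀ j,
        fderiv ℝ J φ (Pi.single i (Pi.single j 1))
          = t φ i * (deriv (c i j) (φ i j * t φ i) + δ j) := by
  have hT : ∀ k, HasFDerivAt (fun ψ => t ψ k) (fderiv ℝ (fun ψ => t ψ k) φ) φ := fun k =>
    (diffAt_t_aux φ hφ ord hloop r t ht k).hasFDerivAt
  generalize hTd : (fun k => fderiv ℝ (fun ψ => t ψ k) φ) = T at *
  replace hT : ∀ k, HasFDerivAt (fun ψ => t ψ k) (T k) φ := by
    intro k
    rw [← hTd]
    exact hT k
  let P : V → V → ((V → V → ℝ) →L[ℝ] ℝ) := fun i j =>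
    (ContinuousLinearMap.proj (R := ℝ) (φ := fun _ : V => ℝ) j).comp
      (ContinuousLinearMap.proj (R := ℝ) (φ := fun _ : V => V → ℝ) i)
  have hP : ∀ i j, HasFDerivAt (fun ψ : V → V → ℝ => ψ i j) (P i j) φ := fun i j =>
    (P i j).hasFDerivAt
  have hTeq : ∀ k, T k = ∑ j, (φ j k • T j + t φ j • P j k) := by
    intro k
    have h1 : HasFDerivAt (fun ψ : V → V → ℝ => r k + ∑ j, ψ j k * t ψ j)
        (∑ j, (φ j k • T j + t φ j • P j k)) φ :=
      (HasFDerivAt.fun_sum fun j _ => (hP j k).mul (hT j)).const_add (r k)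
    exact (hT k).unique (h1.congr_of_eventuallyEq (ht.mono fun ψ hψ => hψ k))
  have hJd : HasFDerivAt J
      ((∑ i, ∑ j, deriv (c i j) (φ i j * t φ i) • (φ i j • T i + t φ i • P i j))
        + ∑ i ∈ X, deriv (h i) (t φ i) • T i) φ := by
    rw [funext hJ]
    refine HasFDerivAt.add (HasFDerivAt.fun_sum fun i _ => HasFDerivAt.fun_sum fun j _ => ?_)
      (HasFDerivAt.fun_sum fun i _ => ?_)
    · exact (hc i j _).hasDerivAt.comp_hasFDerivAt φ ((hP i j).mul (hT i))
    · exact (hh i _).hasDerivAt.comp_hasFDerivAt φ (hT i)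
  refine ⟨hJd.differentiableAt, fun i hi j => ?_⟩
  rw [hJd.fderiv]
  generalize he : (Pi.single i (Pi.single j 1) : V → V → ℝ) = e
  have hPe : ∀ k l, P k l e = if k = i then (if l = j then 1 else 0) else 0 := by
    intro k l
    change e k l = _
    rw [← he]
    by_cases hk : k = i
    · subst hk
      simp [Pi.single_apply]
    · simp [hk]
  have hTe : ∀ k, T k e = ∑ l, φ l k * T l e + if k = j then t φ i else 0 := by
    intro k
    conv_lhs => rw [hTeq k]
    simp [Finset.sum_add_distrib, hPe]
  have hw : ∀ k, (∑ l, deriv (c k l) (φ k l * t φ k) * φ k l)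
      + (if k ∈ X then deriv (h k) (t φ k) else 0) = δ k - ∑ l, φ k l * δ l := by
    intro k
    by_cases hk : k ∈ X
    · simp [hk, hhost k hk, hδX k hk]
    · simp only [hk, if_false, add_zero]
      rw [hδ k hk, ← Finset.sum_sub_distrib]
      refine Finset.sum_congr rfl fun l _ => ?_
      ring
  have hX : ∑ k ∈ X, deriv (h k) (t φ k) * T k e
      = ∑ k, (if k ∈ X then deriv (h k) (t φ k) else 0) * T k e := by
    simp [ite_mul]
  have hS : ∑ k, (δ k - ∑ l, φ k l * δ l) * T k e = t φ i * δ j := by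
    have h1 : ∑ k, δ k * T k e = ∑ k, (∑ l, φ k l * δ l) * T k e + t φ i * δ j := by
      calc ∑ k, δ k * T k e
          = ∑ k, δ k * (∑ l, φ l k * T l e + if k = j then t φ i else 0) :=
            Finset.sum_congr rfl fun k _ => by rw [← hTe k]
        _ = ∑ k, ∑ l, δ k * (φ l k * T l e) + t φ i * δ j := by
            simp [mul_add, Finset.sum_add_distrib, Finset.mul_sum, mul_comm]
        _ = _ := by
            rw [Finset.sum_comm]
            simp only [Finset.sum_mul]
            congr 1
            refine Finset.sum_congr rfl fun k _ => Finset.sum_congr rfl fun l _ => ?_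
            ring
    simp only [sub_mul, Finset.sum_sub_distrib]
    linarith
  have hC : ∑ k, ∑ l, deriv (c k l) (φ k l * t φ k) * (φ k l * T k e + t φ k * P k l e)
      = ∑ k, (∑ l, deriv (c k l) (φ k l * t φ k) * φ k l) * T k e
        + t φ i * deriv (c i j) (φ i j * t φ i) := by
    simp only [mul_add, Finset.sum_add_distrib, Finset.sum_mul, hPe]
    congr 1
    · simp only [mul_assoc]
    · simp [mul_comm]
  simp only [add_apply, ContinuousLinearMap.add_apply, ContinuousLinearMap.sum_apply,
    ContinuousLinearMap.smul_apply, smul_eq_mul]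
  rw [hC, hX, mul_add, ← hS]
  simp only [← hw, add_mul, Finset.sum_add_distrib]
  ring
end

section
/- Let E be a finite-dimensional real inner product space, D ⊆ E a nonempty compact convex set, and f : E → ℝ continuously differentiable with L-Lipschitz gradient (for some L ≥ 0). Let step sizes α : ℕ → ℝ satisfy 0 ≤ α n ≤ 1, Σ_n α n = ∞, and Σ_n (α n)² < ∞. Let x 0 ∈ D, and for each n let d n ∈ D be a minimizer over D of y ↦ ⟪∇f(x n), y⟫, with x (n+1) = x n + α n • (d n − x n). Then there exists a point x* ∈ D and a strictly increasing sequence of indices n_k such that x (n_k) → x* and x* is a first-order stationary point of f on D: for all y ∈ D, ⟪∇f(x*), y − x*⟫ ≥ 0. -/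
open Filter
open scoped RealInnerProductSpace

/-- **Convergence of Frank–Wolfe to a first-order stationary point (Theorem 4).**
For the Frank–Wolfe method with diminishing step sizes (`∑ α n = ∞`, `∑ (α n)² < ∞`)
on a nonempty compact convex set `D`, applied to a `C¹` function `f` with
`L`-Lipschitz gradient, there is a subsequence of the iterates converging to a point
`x* ∈ D` satisfying the first-order stationarity (KKT) condition
`⟪∇f(x*), y − x*⟫ ≥ 0` for all `y ∈ D`. -/
theorem frank_wolfe_converges_to_stationary
    {E : Type*} [NormedAddCommGroup E] [InnerProductSpace ℝ E] [FiniteDimensional ℝ E]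
    (D : Set E) (hDne : D.Nonempty) (hDcomp : IsCompact D) (hDconv : Convex ℝ D)
    (f : E → ℝ) (hf : ContDiff ℝ 1 f)
    (L : ℝ) (hL : 0 ≤ L)
    (hlip : LipschitzWith L.toNNReal (fun x => gradient f x))
    (α : ℕ → ℝ) (hα0 : ∀ n, 0 ≤ α n) (hα1 : ∀ n, α n ≤ 1)
    (hαdiv : Tendsto (fun N => ∑ n ∈ Finset.range N, α n) atTop atTop)
    (hαsq : Summable (fun n => (α n) ^ 2))
    (x d : ℕ → E) (hx0 : x 0 ∈ D)
    (hdmem : ∀ n, d n ∈ D)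
    (hdmin : ∀ n, ∀ y ∈ D, ⟪gradient f (x n), d n⟫ ≤ ⟪gradient f (x n), y⟫)
    (hupd : ∀ n, x (n + 1) = x n + α n • (d n - x n)) :
    ∃ xstar ∈ D, ∃ nk : ℕ → ℕ, StrictMono nk ∧
      Tendsto (fun k => x (nk k)) atTop (nhds xstar) ∧
      ∀ y ∈ D, 0 ≤ ⟪gradient f xstar, y - xstar⟫ := by
  have hxD : ∀ n, x n ∈ D := by
    intro n
    induction n with
    | zero => exact hx0
    | succ n ih =>
      rw [hupd]
      exact hDconv.add_smul_sub_mem ih (hdmem n) ⟨hα0 n, hα1 n⟩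
  have hdiff : Differentiable ℝ f := hf.differentiable (by norm_num)
  have desc : ∀ a b : E, f b ≤ f a + ⟪gradient f a, b - a⟫ + L * ‖b - a‖ ^ 2 := by
    intro a b
    obtain ⟨c, hc, hce⟩ := domain_mvt (f := f) (f' := fun z => fderiv ℝ f z) (s := Set.univ)
      (x := a) (y := b)
      (fun z _ => (hdiff z).hasFDerivAt.hasFDerivWithinAt) convex_univ
      (Set.mem_univ _) (Set.mem_univ _)
    have h1 : fderiv ℝ f c (b - a) = ⟪gradient f c, b - a⟫ := by
      simp [gradient]
    have h2 : ⟪gradient f c, b - a⟫ = ⟪gradient f a, b - a⟫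
        + ⟪gradient f c - gradient f a, b - a⟫ := by
      rw [inner_sub_left]; ring
    have h3 := real_inner_le_norm (gradient f c - gradient f a) (b - a)
    have h4 : ‖gradient f c - gradient f a‖ ≤ L * ‖c - a‖ := by
      have := hlip.dist_le_mul c a
      rwa [Real.coe_toNNReal _ hL, dist_eq_norm, dist_eq_norm] at this
    have h5 : ‖c - a‖ ≤ ‖b - a‖ := by
      have := norm_sub_le_of_mem_segment hc
      exact this
    have h6 : ‖gradient f c - gradient f a‖ * ‖b - a‖ ≤ (L * ‖b - a‖) * ‖b - a‖ := by
      gcongr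
      exact h4.trans (by gcongr)
    nlinarith
  obtain ⟨m, hm⟩ := (hDcomp.image hf.continuous).bddBelow
  have hm' : ∀ n, m ≤ f (x n) := fun n => hm ⟨_, hxD n, rfl⟩
  obtain ⟨C, hC⟩ := Metric.isBounded_iff.1 hDcomp.isBounded
  have step : ∀ n, f (x (n + 1)) ≤ f (x n) - α n * ⟪gradient f (x n), x n - d n⟫
      + L * C ^ 2 * α n ^ 2 := by
    intro n
    have h := desc (x n) (x (n + 1))
    have h1 : x (n + 1) - x n = α n • (d n - x n) := by rw [hupd]; abel
    have h2 : ‖d n - x n‖ ≤ C := by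
      have := hC (hdmem n) (hxD n)
      rwa [dist_eq_norm] at this
    have h3 : ‖d n - x n‖ ^ 2 ≤ C ^ 2 := by gcongr
    have h4 : ⟪gradient f (x n), x n - d n⟫ = - ⟪gradient f (x n), d n - x n⟫ := by
      rw [← inner_neg_right, neg_sub]
    rw [h1, inner_smul_right, norm_smul, mul_pow, Real.norm_eq_abs, sq_abs] at h
    have h5 : L * (α n ^ 2 * ‖d n - x n‖ ^ 2) ≤ L * (α n ^ 2 * C ^ 2) := by gcongr
    rw [h4]
    nlinarith
  have freq : ∀ ε : ℝ, 0 < ε → ∃ᶠ n in atTop, ⟪gradient f (x n), x n - d n⟫ < ε := by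
    intro ε hε hcon
    obtain ⟨N, hN⟩ := eventually_atTop.1 hcon
    have hmono : ∀ n, N ≤ n → f (x n) + ε * ∑ i ∈ Finset.range n, α i
        - L * C ^ 2 * ∑ i ∈ Finset.range n, α i ^ 2 ≤ f (x N) + ε * ∑ i ∈ Finset.range N, α i
        - L * C ^ 2 * ∑ i ∈ Finset.range N, α i ^ 2 := by
      intro n hn
      induction n, hn using Nat.le_induction with
      | base => exact le_rfl
      | succ n hn ih =>
        rw [Finset.sum_range_succ, Finset.sum_range_succ]
        have h1 := step n
        have h2 := mul_le_mul_of_nonneg_left (not_lt.1 (hN n hn)) (hα0 n)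
        nlinarith
    set B := f (x N) + ε * ∑ i ∈ Finset.range N, α i
        - L * C ^ 2 * ∑ i ∈ Finset.range N, α i ^ 2
    have hup := (hαdiv.const_mul_atTop hε).eventually_gt_atTop
      (B + L * C ^ 2 * (∑' i, α i ^ 2) - m)
    obtain ⟨n, h1, h2⟩ := (hup.and (eventually_ge_atTop N)).exists
    have h3 := hmono n h2
    have h4 := hαsq.sum_le_tsum (Finset.range n) (fun i _ => sq_nonneg (α i))
    have h5 : L * C ^ 2 * ∑ i ∈ Finset.range n, α i ^ 2 ≤ L * C ^ 2 * (∑' i, α i ^ 2) := by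
      gcongr
    linarith [hm' n]
  obtain ⟨φ, hφ, hφlt⟩ := extraction_forall_of_frequently
    (fun k : ℕ => freq (1 / ((k : ℝ) + 1)) (by positivity))
  obtain ⟨xs, hxs, ψ, hψ, hlim⟩ := hDcomp.tendsto_subseq (fun k => hxD (φ k))
  refine ⟨xs, hxs, φ ∘ ψ, hφ.comp hψ, hlim, ?_⟩
  intro y hy
  have hg : Tendsto (fun k => gradient f (x (φ (ψ k)))) atTop (nhds (gradient f xs)) :=
    (hlip.continuous.tendsto xs).comp hlim
  have hin : Tendsto (fun k => ⟪gradient f (x (φ (ψ k))), y - x (φ (ψ k))⟫) atTop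
      (nhds ⟪gradient f xs, y - xs⟫) := hg.inner (tendsto_const_nhds.sub hlim)
  have hz : Tendsto (fun k => -(1 / ((ψ k : ℝ) + 1))) atTop (nhds 0) := by
    have := (tendsto_one_div_add_atTop_nhds_zero_nat (𝕜 := ℝ)).comp hψ.tendsto_atTop
    simpa using this.neg
  refine le_of_tendsto_of_tendsto' hz hin (fun k => ?_)
  have h1 := hφlt (ψ k)
  have h2 := hdmin (φ (ψ k)) y hy
  rw [inner_sub_right] at h1 ⊢
  linarith
end

section
/- Let E be a finite-dimensional real inner product space, D ⊆ E a nonempty compact convex set, and f : E → ℝ continuously differentiable with L-Lipschitz gradient (for some L ≥ 0). Let step sizes α : ℕ → ℝ satisfy 0 ≤ α n ≤ 1 and Σ_n (α n)² < ∞. Let x 0 ∈ D, and for each n let d n ∈ D be a minimizer over D of y ↦ ⟪∇f(x n), y⟫, with x (n+1) = x n + α n • (d n − x n). Then the sequence of objective values f(x n) converges in ℝ. -/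
open Filter
open scoped RealInnerProductSpace

theorem fw_descent
    {E : Type*} [NormedAddCommGroup E] [InnerProductSpace ℝ E] [CompleteSpace E]
    (f : E → ℝ) (hf : Differentiable ℝ f) (L : ℝ) (hL : 0 ≤ L)
    (hlip : LipschitzWith L.toNNReal (fun x => gradient f x)) (x v : E) :
    f (x + v) ≤ f x + ⟪gradient f x, v⟫ + L * ‖v‖ ^ 2 := by
  have hd : ∀ t : ℝ, HasDerivAt (fun t : ℝ => f (x + t • v)) ⟪gradient f (x + t • v), v⟫ t := by
    intro t
    have h1 : HasDerivAt (fun t : ℝ => x + t • v) v t := by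
      simpa using ((hasDerivAt_id t).smul_const v).const_add x
    have h2 := ((hf (x + t • v)).hasGradientAt.hasFDerivAt).comp_hasDerivAt t h1
    simpa [Function.comp_def] using h2
  obtain ⟨c, hc, hceq⟩ := exists_hasDerivAt_eq_slope (fun t : ℝ => f (x + t • v))
    (fun t => ⟪gradient f (x + t • v), v⟫) zero_lt_one
    (fun t _ => (hd t).continuousAt.continuousWithinAt) (fun t _ => hd t)
  simp only [one_smul, zero_smul, add_zero, sub_zero, div_one] at hceq
  have h3 : ⟪gradient f (x + c • v) - gradient f x, v⟫ ≤ L * ‖v‖ ^ 2 := by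
    have h4 := real_inner_le_norm (gradient f (x + c • v) - gradient f x) v
    have h5 := hlip.norm_sub_le (x + c • v) x
    rw [Real.coe_toNNReal L hL, add_sub_cancel_left, norm_smul, Real.norm_eq_abs,
      abs_of_pos hc.1] at h5
    have h6 : L * (c * ‖v‖) ≤ L * ‖v‖ :=
      mul_le_mul_of_nonneg_left (mul_le_of_le_one_left (norm_nonneg v) hc.2.le) hL
    have h7 := mul_le_mul_of_nonneg_right (h5.trans h6) (norm_nonneg v)
    nlinarith
  rw [inner_sub_left] at h3
  linarith

/-- **Convergence of the objective values along Frank–Wolfe iterates.** For the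
Frank–Wolfe method with step sizes `0 ≤ α n ≤ 1` and `∑ (α n)² < ∞` on a nonempty
compact convex set `D`, applied to a `C¹` function `f` with `L`-Lipschitz gradient,
the sequence of objective values `f (x n)` converges in `ℝ`. -/
theorem frank_wolfe_objective_converges
    {E : Type*} [NormedAddCommGroup E] [InnerProductSpace ℝ E] [FiniteDimensional ℝ E]
    (D : Set E) (hDne : D.Nonempty) (hDcomp : IsCompact D) (hDconv : Convex ℝ D)
    (f : E → ℝ) (hf : ContDiff ℝ 1 f)
    (L : ℝ) (hL : 0 ≤ L)
    (hlip : LipschitzWith L.toNNReal (fun x => gradient f x))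
    (α : ℕ → ℝ) (hα0 : ∀ n, 0 ≤ α n) (hα1 : ∀ n, α n ≤ 1)
    (hαsq : Summable (fun n => (α n) ^ 2))
    (x d : ℕ → E) (hx0 : x 0 ∈ D)
    (hdmem : ∀ n, d n ∈ D)
    (hdmin : ∀ n, ∀ y ∈ D, ⟪gradient f (x n), d n⟫ ≤ ⟪gradient f (x n), y⟫)
    (hupd : ∀ n, x (n + 1) = x n + α n • (d n - x n)) :
    ∃ c : ℝ, Tendsto (fun n => f (x n)) atTop (nhds c) := by
  haveI : CompleteSpace E := FiniteDimensional.complete ℝ E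
  have hxD : ∀ n, x n ∈ D := by
    intro n
    induction n with
    | zero => exact hx0
    | succ n ih =>
      rw [hupd n]
      exact hDconv.add_smul_sub_mem ih (hdmem n) ⟨hα0 n, hα1 n⟩
  have hstep : ∀ n, f (x (n + 1)) ≤ f (x n) + L * Metric.diam D ^ 2 * α n ^ 2 := by
    intro n
    have h1 := fw_descent f (hf.differentiable (by norm_num)) L hL hlip (x n) (α n • (d n - x n))
    rw [← hupd n, real_inner_smul_right, inner_sub_right, norm_smul, Real.norm_eq_abs,
      mul_pow, sq_abs] at h1
    have h2 : ‖d n - x n‖ ≤ Metric.diam D := by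
      rw [← dist_eq_norm]
      exact Metric.dist_le_diam_of_mem hDcomp.isBounded (hdmem n) (hxD n)
    have h3 := mul_nonneg (hα0 n) (sub_nonneg.2 (hdmin n (x n) (hxD n)))
    have h4 : ‖d n - x n‖ ^ 2 ≤ Metric.diam D ^ 2 := by gcongr
    have h5 := mul_le_mul_of_nonneg_left h4 (mul_nonneg hL (sq_nonneg (α n)))
    nlinarith
  have hsum := hαsq.mul_left (L * Metric.diam D ^ 2)
  obtain ⟨m, hm⟩ := (hDcomp.image_of_continuousOn hf.continuous.continuousOn).bddBelow
  have hanti : Antitone (fun n => f (x n) -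
      ∑ i ∈ Finset.range n, L * Metric.diam D ^ 2 * α i ^ 2) := by
    refine antitone_nat_of_succ_le fun n => ?_
    simp only [Finset.sum_range_succ]
    linarith [hstep n]
  have hbdd : BddBelow (Set.range (fun n => f (x n) -
      ∑ i ∈ Finset.range n, L * Metric.diam D ^ 2 * α i ^ 2)) := by
    refine ⟨m - ∑' i, L * Metric.diam D ^ 2 * α i ^ 2, ?_⟩
    rintro _ ⟨n, rfl⟩
    have h1 := hm (Set.mem_image_of_mem f (hxD n))
    have h2 := hsum.sum_le_tsum (Finset.range n) (fun i _ => by positivity)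
    simp only
    linarith
  have ht := (tendsto_atTop_ciInf hanti hbdd).add hsum.hasSum.tendsto_sum_nat
  refine ⟨_, ht.congr fun n => ?_⟩
  ring
end

section
/- Let V be a finite node set, X ⊆ V a host set, E ⊆ V × V a set of directed edges admitting an injective ord : V → ℕ with ord i < ord j for every (i,j) ∈ E (so E is acyclic), edge delays d : V → V → ℝ, and host processing delays c : V → ℝ. Assume every i ∉ X has at least one outgoing edge in E, and define the optimal cost σ : V → ℝ by σ i = c i for i ∈ X and σ i = min_{j : (i,j) ∈ E} (d i j + σ j) for i ∉ X (well-defined by acyclicity). Let φ : V → V → ℝ be a routing variable supported on E (φ i j > 0 only if (i,j) ∈ E) satisfying flow conservation with respect to X, and let D : V → ℝ be the unique solution of D i = c i for i ∈ X and D i = Σ_j φ i j (d i j + D j) for i ∉ X. Then: (a) D i ≥ σ i for all i ∈ V; and (b) if moreover φ i j > 0 implies d i j + σ j = σ i, then D i = σ i for all i. -/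
/-- **Probabilistic hop-by-hop routing versus Bellman shortest paths (mechanism of
Proposition 2).** On an acyclic edge set `E` with constant edge delays `d` and host
delays `c`, let `σ` be the Bellman optimal cost (`σ i = c i` on `X`,
`σ i = min_{(i,j) ∈ E} (d i j + σ j)` off `X`). For any routing variable `φ`
supported on `E` and flow-conserving w.r.t. `X`, with expected latency `D` solving
`D i = c i` on `X` and `D i = ∑ j, φ i j * (d i j + D j)` off `X`:
(a) `D i ≥ σ i` everywhere, and (b) if `φ` is supported on Bellman-optimal edges
(`φ i j > 0 → d i j + σ j = σ i`), then `D = σ`. -/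
theorem routing_latency_vs_bellman
    {V : Type*} [Fintype V] [DecidableEq V]
    (X : Finset V) (E : Finset (V × V))
    (ord : V → ℕ) (hord : Function.Injective ord)
    (hacyc : ∀ e ∈ E, ord e.1 < ord e.2)
    (d : V → V → ℝ) (c : V → ℝ)
    (hout : ∀ i ∉ X, ∃ j, (i, j) ∈ E)
    (σ : V → ℝ)
    (hσX : ∀ i ∈ X, σ i = c i)
    (hσmem : ∀ i ∉ X, ∃ j, (i, j) ∈ E ∧ σ i = d i j + σ j)
    (hσle : ∀ i ∉ X, ∀ j, (i, j) ∈ E → σ i ≤ d i j + σ j)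
    (φ : V → V → ℝ) (hφ : ∀ i j, 0 ≤ φ i j)
    (hsupp : ∀ i j, 0 < φ i j → (i, j) ∈ E)
    (hcons : ∀ i ∉ X, ∑ j, φ i j = 1)
    (hhost : ∀ i ∈ X, ∀ j, φ i j = 0)
    (D : V → ℝ)
    (hDX : ∀ i ∈ X, D i = c i)
    (hD : ∀ i ∉ X, D i = ∑ j, φ i j * (d i j + D j)) :
    (∀ i, σ i ≤ D i) ∧
      ((∀ i j, 0 < φ i j → d i j + σ j = σ i) → ∀ i, D i = σ i) := by
  have ind : ∀ P : V → Prop, (∀ i, (∀ j, (i, j) ∈ E → P j) → P i) → ∀ i, P i := by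
    intro P hP
    have key : ∀ n : ℕ, ∀ i, (Finset.univ.sup ord) - ord i < n → P i := by
      intro n
      induction n with
      | zero => intro i hi; omega
      | succ n ih =>
        intro i hi
        apply hP
        intro j hj
        apply ih
        have h1 : ord i < ord j := hacyc _ hj
        have h2 : ord j ≤ Finset.univ.sup ord := Finset.le_sup (Finset.mem_univ j)
        omega
    intro i
    exact key _ i (Nat.lt_succ_self _)
  have avg : ∀ i ∉ X, σ i = ∑ j, φ i j * σ i := by
    intro i hi
    rw [← Finset.sum_mul, hcons i hi, one_mul]
  constructor
  · apply ind
    intro i ih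
    by_cases hi : i ∈ X
    · rw [hσX i hi, hDX i hi]
    · rw [hD i hi, avg i hi]
      apply Finset.sum_le_sum
      intro j _
      rcases (hφ i j).eq_or_lt with h | h
      · simp [← h]
      · have hE := hsupp i j h
        have h1 := hσle i hi j hE
        have h2 := ih j hE
        exact mul_le_mul_of_nonneg_left (by linarith) h.le
  · intro hopt
    apply ind
    intro i ih
    by_cases hi : i ∈ X
    · rw [hσX i hi, hDX i hi]
    · rw [hD i hi, avg i hi]
      apply Finset.sum_congr rfl
      intro j _
      rcases (hφ i j).eq_or_lt with h | h
      · simp [← h]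
      · rw [ih j (hsupp i j h), hopt i j h]
end
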